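/- Let a > 0 be a real and let l be an integer with 0 ≤ l ≤ min{ n−1, a·n/(M+a) }, where M := M_∞·p̄ − m_∞·p. Then app(n−l) ≤ opt(n−l) + a, i.e. Algorithm 1 returns a solution with additive approximation guarantee at most a for k = n−l. -/

import Mathlib

open scoped BigOperators

/-- Dot product of two vectors in `ℝ^ν`. -/
noncomputable def dot {ν : ℕ} (c x : Fin ν → ℝ) : ℝ := ∑ j, c j * x j

/-- `convComb X k` is the set `X(k)` of all convex combinations of at most `k` points of `X`. -/
def convComb {ν : ℕ} (X : Set (Fin ν → ℝ)) (k : ℕ) : Set (Fin ν → ℝ) :=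
  { x | ∃ (xs : Fin k → (Fin ν → ℝ)) (lam : Fin k → ℝ),
      (∀ i, xs i ∈ X) ∧ (∀ i, 0 ≤ lam i) ∧ (∑ i, lam i) = 1 ∧
      x = ∑ i, lam i • xs i }

/-- The worst-case objective `max_{c ∈ U} cᵀx`. -/
noncomputable def objSup {ν : ℕ} (U : Set (Fin ν → ℝ)) (x : Fin ν → ℝ) : ℝ :=
  sSup ((fun c => dot c x) '' U)

/-- `opt(k) = min_{x ∈ X(k)} max_{c ∈ U} cᵀx`. -/
noncomputable def optVal {ν : ℕ} (X U : Set (Fin ν → ℝ)) (k : ℕ) : ℝ :=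
  sInf (objSup U '' convComb X k)

/-- `‖x‖₀`, the number of nonzero entries of `x`, as a real number. -/
noncomputable def zeroNorm {ν : ℕ} (x : Fin ν → ℝ) : ℝ :=
  ((Finset.univ.filter (fun j => x j ≠ 0)).card : ℝ)

/-- The min-max-min robust value over `k`-tuples of feasible solutions:
`min_{x¹,…,x^k ∈ X} max_{c ∈ U} min_{i} cᵀxⁱ`. -/
noncomputable def minmaxVal {ν : ℕ} (X U : Set (Fin ν → ℝ)) (k : ℕ) : ℝ :=
  sInf { v : ℝ | ∃ xs : Fin k → (Fin ν → ℝ), (∀ i, xs i ∈ X) ∧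
    v = sSup ((fun c => ⨅ i, dot c (xs i)) '' U) }

/-- `app(k)`, the objective value of the `k` solutions `x¹,…,x^k` with largest weights
returned by Algorithm 1: `max_{c ∈ U} min_{i=1,…,k} cᵀxⁱ`. -/
noncomputable def appVal {ν : ℕ} (U : Set (Fin ν → ℝ)) (xs : Fin ν → (Fin ν → ℝ)) (k : ℕ) : ℝ :=
  sSup ((fun c => ⨅ i : {i : Fin ν // (i : ℕ) < k}, dot c (xs i.1)) '' U)

lemma convComb_subset_add {ν : ℕ} {X : Set (Fin ν → ℝ)} (hX : X.Nonempty) (k l : ℕ) :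
    convComb X k ⊆ convComb X (k + l) := by
  rintro x ⟨xs, lam, hxs, hlam, hsum, rfl⟩
  obtain ⟨x₀, hx₀⟩ := hX
  refine ⟨Fin.append xs fun _ => x₀, Fin.append lam fun _ => 0, fun i => ?_, fun i => ?_, ?_, ?_⟩
  · refine Fin.addCases (fun i => ?_) (fun i => ?_) i
    · simpa using hxs i
    · simpa using hx₀
  · refine Fin.addCases (fun i => ?_) (fun i => ?_) i
    · simpa using hlam i
    · simp
  · simp [Fin.sum_univ_add, hsum]
  · simp [Fin.sum_univ_add]

lemma convComb_nonempty {ν : ℕ} {X : Set (Fin ν → ℝ)} (hX : X.Nonempty) {k : ℕ} (hk : 0 < k) :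
    (convComb X k).Nonempty := by
  obtain ⟨x₀, hx₀⟩ := hX
  refine ⟨_, fun _ => x₀, fun _ => (1 : ℝ) / k, fun _ => hx₀, fun _ => by positivity, ?_, rfl⟩
  have : (k : ℝ) ≠ 0 := by positivity
  simp [this]

lemma dot_sum_smul {ν k : ℕ} (c : Fin ν → ℝ) (lam : Fin k → ℝ) (xs : Fin k → Fin ν → ℝ) :
    dot c (∑ i, lam i • xs i) = ∑ i, lam i * dot c (xs i) := by
  simp only [dot, Finset.sum_apply, Pi.smul_apply, smul_eq_mul, Finset.mul_sum]
  rw [Finset.sum_comm]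
  exact Finset.sum_congr rfl fun i _ => Finset.sum_congr rfl fun j _ => by ring

lemma dot_le_objSup {ν : ℕ} {U : Set (Fin ν → ℝ)} (hU : IsCompact U) {c : Fin ν → ℝ}
    (hc : c ∈ U) (x : Fin ν → ℝ) : dot c x ≤ objSup U x := by
  have hcont : Continuous fun c : Fin ν → ℝ => dot c x := by
    unfold dot
    fun_prop
  exact le_csSup (hU.image hcont).bddAbove ⟨c, hc, rfl⟩

lemma optVal_add_le {ν : ℕ} {X U : Set (Fin ν → ℝ)} (hX : X.Nonempty)
    (hX0 : ∀ x ∈ X, ∀ j, 0 ≤ x j) (hUne : U.Nonempty) (hU : IsCompact U)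
    (hU0 : ∀ c ∈ U, ∀ j, 0 ≤ c j) {k : ℕ} (hk : 0 < k) (l : ℕ) :
    optVal X U (k + l) ≤ optVal X U k := by
  obtain ⟨c, hc⟩ := hUne
  refine csInf_le_csInf ⟨0, ?_⟩ ((convComb_nonempty hX hk).image _)
    (Set.image_mono (convComb_subset_add hX k l))
  rintro _ ⟨_, ⟨xs, lam, hxs, hlam, -, rfl⟩, rfl⟩
  refine le_trans ?_ (dot_le_objSup hU hc _)
  rw [dot_sum_smul]
  exact Finset.sum_nonneg fun i _ => mul_nonneg (hlam i) <|
    Finset.sum_nonneg fun j _ => mul_nonneg (hU0 c hc j) (hX0 _ (hxs i) j)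

/-- A dot product with a binary vector lies between the extreme entries of the cost vector
times the number of nonzero entries. -/
lemma dot_bounds_of_binary {ν : ℕ} {c x : Fin ν → ℝ} {m M : ℝ} (hx : ∀ j, x j = 0 ∨ x j = 1)
    (hc : ∀ j, m ≤ c j ∧ c j ≤ M) : m * zeroNorm x ≤ dot c x ∧ dot c x ≤ M * zeroNorm x := by
  have hz : zeroNorm x = ∑ j, x j := by
    rw [zeroNorm, Finset.card_filter, Nat.cast_sum]
    refine Finset.sum_congr rfl fun j _ => ?_
    rcases hx j with h | h <;> simp [h]
  have hx0 : ∀ j, 0 ≤ x j := fun j => by rcases hx j with h | h <;> simp [h]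
  rw [hz, dot, Finset.mul_sum, Finset.mul_sum]
  exact ⟨Finset.sum_le_sum fun j _ => mul_le_mul_of_nonneg_right (hc j).1 (hx0 j),
    Finset.sum_le_sum fun j _ => mul_le_mul_of_nonneg_right (hc j).2 (hx0 j)⟩

/-- The `l` smallest of `k + l` weights summing to one have total at most `l / (k + l)`. -/
lemma mul_sum_natAdd_le {k l : ℕ} {lam : Fin (k + l) → ℝ} (hsum : ∑ i, lam i = 1)
    (hsort : Antitone lam) : ((k + l : ℕ) : ℝ) * ∑ i : Fin l, lam (Fin.natAdd k i) ≤ l := by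
  have h : ∑ i : Fin l, ∑ _j : Fin k, lam (Fin.natAdd k i) ≤
      ∑ _i : Fin l, ∑ j : Fin k, lam (Fin.castAdd l j) :=
    Finset.sum_le_sum fun i _ => Finset.sum_le_sum fun j _ => hsort (by
      simp only [Fin.le_def, Fin.val_castAdd, Fin.val_natAdd]
      omega)
  simp only [Finset.sum_const, Finset.card_univ, Fintype.card_fin, nsmul_eq_mul,
    ← Finset.mul_sum] at h
  rw [Fin.sum_univ_add] at hsum
  push_cast
  rw [eq_sub_of_add_eq hsum] at h
  linarith

lemma appVal_le_objSup_add {k l : ℕ} {U : Set (Fin (k + l) → ℝ)} (hUne : U.Nonempty)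
    (hU : IsCompact U) (hk : 0 < k) {xs : Fin (k + l) → Fin (k + l) → ℝ} {lam : Fin (k + l) → ℝ}
    (hlam : ∀ i, 0 ≤ lam i) (hsum : ∑ i, lam i = 1) {A B : ℝ}
    (hA : ∀ c ∈ U, ∀ i, A ≤ dot c (xs i)) (hB : ∀ c ∈ U, ∀ i, dot c (xs i) ≤ B) :
    appVal U xs k ≤
      objSup U (∑ i, lam i • xs i) + (∑ i : Fin l, lam (Fin.natAdd k i)) * (B - A) := by
  refine csSup_le (hUne.image _) ?_
  rintro _ ⟨c, hc, rfl⟩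
  have hle : ∀ i : {i : Fin (k + l) // (i : ℕ) < k},
      (⨅ i : {i : Fin (k + l) // (i : ℕ) < k}, dot c (xs i.1)) ≤ dot c (xs i.1) :=
    fun i => ciInf_le (Set.finite_range _).bddBelow i
  beta_reduce
  set m := ⨅ i : {i : Fin (k + l) // (i : ℕ) < k}, dot c (xs i.1)
  have hmB : m ≤ B := (hle ⟨⟨0, by omega⟩, hk⟩).trans (hB c hc _)
  have hx := dot_le_objSup hU hc (∑ i, lam i • xs i)
  rw [dot_sum_smul, Fin.sum_univ_add] at hx
  have h1 : ∑ i : Fin k, lam (Fin.castAdd l i) * m ≤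
      ∑ i : Fin k, lam (Fin.castAdd l i) * dot c (xs (Fin.castAdd l i)) :=
    Finset.sum_le_sum fun i _ =>
      mul_le_mul_of_nonneg_left (hle ⟨Fin.castAdd l i, i.2⟩) (hlam _)
  have h2 : ∑ i : Fin l, lam (Fin.natAdd k i) * (m - (B - A)) ≤
      ∑ i : Fin l, lam (Fin.natAdd k i) * dot c (xs (Fin.natAdd k i)) :=
    Finset.sum_le_sum fun i _ => mul_le_mul_of_nonneg_left
      (by linarith [hA c hc (Fin.natAdd k i)]) (hlam _)
  rw [← Finset.sum_mul] at h1 h2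
  rw [Fin.sum_univ_add] at hsum
  rw [eq_sub_of_add_eq hsum] at h1
  linarith

/-- If `a > 0` and `0 ≤ l ≤ min{n−1, a·n/(M+a)}` with `M = M_∞·p̄ − m_∞·p`,
then Algorithm 1 returns a solution with additive approximation guarantee at most `a`
for `k = n−l`: `app(n−l) ≤ opt(n−l) + a`. -/
theorem stmt7 (n : ℕ) (hn : 0 < n)
    (X : Set (Fin n → ℝ)) (hXfin : X.Finite) (hXne : X.Nonempty)
    (hXbin : ∀ x ∈ X, ∀ j, x j = 0 ∨ x j = 1)
    (U : Set (Fin n → ℝ)) (hUne : U.Nonempty) (hUcomp : IsCompact U) (hUconv : Convex ℝ U)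
    (m_inf M_inf : ℝ) (hm : 0 < m_inf) (hmM : m_inf ≤ M_inf)
    (hc : ∀ c ∈ U, ∀ j, m_inf ≤ c j ∧ c j ≤ M_inf)
    (p pbar : ℝ) (hp0 : 0 ≤ p) (hppbar : p ≤ pbar)
    (hpx : ∀ x ∈ X, p ≤ zeroNorm x ∧ zeroNorm x ≤ pbar)
    (xs : Fin n → (Fin n → ℝ)) (lam : Fin n → ℝ)
    (hxs : ∀ i, xs i ∈ X) (hlam0 : ∀ i, 0 ≤ lam i) (hlamsum : (∑ i, lam i) = 1)
    (hlamsort : ∀ i j : Fin n, i ≤ j → lam j ≤ lam i)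
    (hopt : objSup U (∑ i, lam i • xs i) = optVal X U n)
    (a : ℝ) (ha : 0 < a) (l : ℕ)
    (hl : (l : ℝ) ≤ min ((n : ℝ) - 1) (a * (n : ℝ) / ((M_inf * pbar - m_inf * p) + a))) :
    appVal U xs (n - l) ≤ optVal X U (n - l) + a := by
  have hlt : l < n := by
    have h := hl.trans (min_le_left _ _)
    have : (l : ℝ) < n := by linarith
    exact_mod_cast this
  obtain ⟨k, rfl⟩ : ∃ k, n = k + l := ⟨n - l, by omega⟩
  have hk : 0 < k := by omega
  rw [Nat.add_sub_cancel]
  have hX0 : ∀ x ∈ X, ∀ j, 0 ≤ x j := fun x hx j => by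
    rcases hXbin x hx j with h | h <;> simp [h]
  have hMpos : 0 ≤ M_inf * pbar - m_inf * p :=
    sub_nonneg.2 (mul_le_mul hmM hppbar hp0 (hm.le.trans hmM))
  have happ := appVal_le_objSup_add hUne hUcomp hk hlam0 hlamsum
    (fun c hcU i => (mul_le_mul_of_nonneg_left (hpx _ (hxs i)).1 hm.le).trans
      (dot_bounds_of_binary (hXbin _ (hxs i)) (hc c hcU)).1)
    (fun c hcU i => (dot_bounds_of_binary (hXbin _ (hxs i)) (hc c hcU)).2.trans
      (mul_le_mul_of_nonneg_left (hpx _ (hxs i)).2 (hm.le.trans hmM)))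
  have hmono := optVal_add_le hXne hX0 hUne hUcomp
    (fun c hcU j => hm.le.trans (hc c hcU j).1) hk l
  have htail := mul_sum_natAdd_le hlamsum fun i j hij => hlamsort i j hij
  have hlM := (le_div_iff₀ (by linarith)).1 (hl.trans (min_le_right _ _))
  have hn' : (0 : ℝ) < ((k + l : ℕ) : ℝ) := by exact_mod_cast hn
  have hla : (0 : ℝ) ≤ l * a := by positivity
  have hbound : (∑ i : Fin l, lam (Fin.natAdd k i)) * (M_inf * pbar - m_inf * p) ≤ a := by
    refine le_of_mul_le_mul_left ?_ hn'
    linarith [mul_le_mul_of_nonneg_right htail hMpos]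
  linarith
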